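/- Let d ≥ 2, let {r_n} ⊂ (0,1) with r_n → 0⁺ and {s_n} ⊂ (1,+∞) with s_n → 1⁺. For every ε > 0 there exist δ₀ > 0 and n̄ ∈ ℕ such that for every ν ∈ 𝕊^{d−1}, every measurable set E ⊆ ℝ^d of finite Lebesgue measure with |(E △ H⁻_ν(0)) ∩ Q^ν| < δ₀, and every n ≥ n̄, ∫_{Q^ν∩E} ∫_{Q^ν∩E^c} k^{s_n}_{r_n}(|x−y|) dy dx ≥ ω_{d−1}·(1−ε)·β(r_n, s_n). -/

import Mathlib

open MeasureTheory Filter Set Metric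
open scoped ENNReal NNReal symmDiff

noncomputable section

abbrev Euc (d : ℕ) : Type := EuclideanSpace ℝ (Fin d)

/-- The kernel `k^s_r`. -/
def ker (d : ℕ) (s r t : ℝ) : ℝ :=
  if t ≤ r then r ^ (-((d : ℝ) + s)) else t ^ (-((d : ℝ) + s))

/-- The regularized `s`-fractional perimeter `J̃_r^s(E) = ∫_E ∫_{Eᶜ} k^s_r(|x-y|) dy dx`. -/
def Jt (d : ℕ) (s r : ℝ) (E : Set (Euc d)) : ℝ≥0∞ :=
  ∫⁻ x in E, ∫⁻ y in Eᶜ, ENNReal.ofReal (ker d s r (dist x y))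

/-- The scaling factor `σ^s(r)`. -/
def sgm (d : ℕ) (s r : ℝ) : ℝ :=
  if s = 1 then |Real.log r| else (((d : ℝ) + s) / ((d : ℝ) + 1)) * r ^ (1 - s) / (s - 1)

/-- The scaling factor `β(r,s)` for the simultaneous limit. -/
def betaScale (d : ℕ) (s r : ℝ) : ℝ :=
  (((d : ℝ) + s) / ((d : ℝ) + 1)) * ((r ^ (1 - s) - 1) / (s - 1)) + 1 / ((d : ℝ) + 1)

/-- `ω_k`: Lebesgue measure of the unit ball in `ℝ^k`. -/
def omegaB (k : ℕ) : ℝ := (volume (ball (0 : Euc k) 1)).toReal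

/-- Divergence of a vector field on `ℝ^d`. -/
def diverg {d : ℕ} (Φ : Euc d → Euc d) (x : Euc d) : ℝ :=
  ∑ i : Fin d, fderiv ℝ Φ x (EuclideanSpace.single i 1) i

/-- De Giorgi perimeter. -/
def Per (d : ℕ) (E : Set (Euc d)) : ℝ≥0∞ :=
  ⨆ (Φ : Euc d → Euc d) (_ : ContDiff ℝ 1 Φ) (_ : HasCompactSupport Φ)
    (_ : ∀ x, ‖Φ x‖ ≤ 1), ENNReal.ofReal (∫ x in E, diverg Φ x)

/-- The cube `lQ + ξ` where `Q = [-1/2, 1/2)^d`. -/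
def cube (d : ℕ) (l : ℝ) (ξ : Euc d) : Set (Euc d) :=
  {x | ∀ i, x i ∈ Set.Ico (ξ i - l / 2) (ξ i + l / 2)}

/-- Half space `H⁻_ν(0)`. -/
def Hminus (d : ℕ) (ν : Euc d) : Set (Euc d) := {y | @inner ℝ _ _ ν y ≤ 0}

/-- Standard (normalized) `k`-dimensional Hausdorff measure on `ℝ^d`:
Mathlib's `μH[k]` uses `diam^k` gauges without the normalizing constant `ω_k/2^k`. -/
def Hstd (d : ℕ) (k : ℕ) : Measure (Euc d) :=
  (ENNReal.ofReal (omegaB k / 2 ^ k)) • (μH[(k : ℝ)] : Measure (Euc d))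

/-- The nonlocal `k^s_r`-curvature. -/
def curv (d : ℕ) (s r : ℝ) (E : Set (Euc d)) (x : Euc d) : ℝ :=
  ∫ y, (Set.indicator Eᶜ (fun _ => (1 : ℝ)) y - Set.indicator E (fun _ => (1 : ℝ)) y)
    * ker d s r (dist x y)

/-- The class `𝔈`: closures of open sets with compact `C²` boundary. -/
def IsC2Domain (d : ℕ) (E : Set (Euc d)) : Prop :=
  ∃ U : Set (Euc d), IsOpen U ∧ E = closure U ∧ IsCompact (frontier U) ∧
    ∃ f : Euc d → ℝ, ContDiff ℝ 2 f ∧ U = {x | f x < 0} ∧ frontier U = {x | f x = 0} ∧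
      ∀ x ∈ frontier U, fderiv ℝ f x ≠ 0


lemma polarAux (m : ℕ) (f : ℝ → ℝ≥0∞) (hf : Measurable f) (g : Euc (m+1) → ℝ≥0∞)
    (hg : Measurable g) (hgh : ∀ (c : ℝ) (x : Euc (m+1)), 0 < c → g (c • x) = ENNReal.ofReal c * g x) :
    ∫⁻ x, f ‖x‖ * g x = (∫⁻ θ : sphere (0 : Euc (m+1)) 1, g θ ∂(volume : Measure (Euc (m+1))).toSphere)
      * ∫⁻ ρ in Ioi (0:ℝ), f ρ * ENNReal.ofReal (ρ ^ (m+1)) := by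
  have hdim : Module.finrank ℝ (Euc (m+1)) - 1 = m := by simp
  have hmp := (volume : Measure (Euc (m+1))).measurePreserving_homeomorphUnitSphereProd
  rw [hdim] at hmp
  have h1 : ∫⁻ x, f ‖x‖ * g x = ∫⁻ x : ({(0 : Euc (m+1))}ᶜ : Set (Euc (m+1))), f ‖x.1‖ * g x.1 ∂(volume.comap Subtype.val) := by
    rw [lintegral_subtype_comap (measurableSet_singleton _).compl (fun x => f ‖x‖ * g x), restrict_compl_singleton]
  have h2 := hmp.lintegral_comp_emb (Homeomorph.measurableEmbedding _)
    (fun p : (sphere (0 : Euc (m+1)) 1) × (Ioi (0:ℝ)) => f p.2.1 * (ENNReal.ofReal p.2.1 * g p.1))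
  have h3 : ∀ x : ({(0 : Euc (m+1))}ᶜ : Set (Euc (m+1))),
     f ‖x.1‖ * g x.1 = (fun p : (sphere (0 : Euc (m+1)) 1) × (Ioi (0:ℝ)) => f p.2.1 * (ENNReal.ofReal p.2.1 * g p.1)) (homeomorphUnitSphereProd (Euc (m+1)) x) := by
    intro x
    have hx : 0 < ‖x.1‖ := norm_pos_iff.2 x.2
    have : g x.1 = ENNReal.ofReal ‖x.1‖ * g (‖x.1‖⁻¹ • x.1) := by
      rw [← hgh _ _ hx, smul_smul, mul_inv_cancel₀ hx.ne', one_smul]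
    simp only [homeomorphUnitSphereProd_apply_snd_coe, homeomorphUnitSphereProd_apply_fst_coe]
    rw [← this]
  rw [h1, lintegral_congr h3, h2]
  have h4 : ∀ p : (sphere (0 : Euc (m+1)) 1) × (Ioi (0:ℝ)), f p.2.1 * (ENNReal.ofReal p.2.1 * g p.1)
    = g p.1 * (f p.2.1 * ENNReal.ofReal p.2.1) := fun p => by ring
  rw [lintegral_congr h4]
  have hm1 : Measurable (fun θ : sphere (0 : Euc (m+1)) 1 => g θ) := hg.comp measurable_subtype_coe
  have hm2 : Measurable (fun ρ : Ioi (0:ℝ) => f ρ.1 * ENNReal.ofReal ρ.1) := by fun_prop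
  rw [lintegral_prod_mul hm1.aemeasurable hm2.aemeasurable]
  congr 1
  rw [Measure.volumeIoiPow, lintegral_withDensity_eq_lintegral_mul _ (by fun_prop) hm2]
  rw [← lintegral_subtype_comap measurableSet_Ioi]
  refine lintegral_congr fun ρ => ?_
  have : (0:ℝ) < ρ.1 := ρ.2
  simp only [Pi.mul_apply]
  rw [pow_succ, ENNReal.ofReal_mul (by positivity)]
  ring

lemma polarBall (m : ℕ) (g : Euc (m+1) → ℝ≥0∞)
    (hg : Measurable g) (hgh : ∀ (c : ℝ) (x : Euc (m+1)), 0 < c → g (c • x) = ENNReal.ofReal c * g x) :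
    (∫⁻ θ : sphere (0 : Euc (m+1)) 1, g θ ∂(volume : Measure (Euc (m+1))).toSphere) * ENNReal.ofReal (1/(m+2)) =
      ∫⁻ x, (Iio (1:ℝ)).indicator 1 ‖x‖ * g x := by
  rw [polarAux m _ (measurable_one.indicator measurableSet_Iio) g hg hgh]
  congr 1
  have : ∀ ρ : ℝ, (Iio (1:ℝ)).indicator (1 : ℝ → ℝ≥0∞) ρ * ENNReal.ofReal (ρ ^ (m+1))
     = (Iio (1:ℝ)).indicator (fun ρ => ENNReal.ofReal (ρ ^ (m+1))) ρ := by
    intro ρ; by_cases h : ρ < 1 <;> simp [h]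
  rw [lintegral_congr this, lintegral_indicator measurableSet_Iio, Measure.restrict_restrict measurableSet_Iio,
    Set.inter_comm, Ioi_inter_Iio, Measure.restrict_congr_set Ioo_ae_eq_Ioc,
    ← ofReal_integral_eq_lintegral_ofReal (intervalIntegral.intervalIntegrable_pow _).1, ← intervalIntegral.integral_of_le zero_le_one]
  · simp; norm_num [add_assoc]
  · filter_upwards [ae_restrict_mem measurableSet_Ioc] with y hy
    have := hy.1
    positivity

lemma sliceInt (m : ℕ) : ∫⁻ t in Ioo (0:ℝ) 1, ENNReal.ofReal (t * (√(1 - t^2)) ^ m) = ENNReal.ofReal (1/(m+2)) := by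
  have hc : Continuous (fun t : ℝ => t * (√(1 - t^2)) ^ m) := by fun_prop
  rw [Measure.restrict_congr_set Ioo_ae_eq_Ioc,
    ← ofReal_integral_eq_lintegral_ofReal (hc.intervalIntegrable _ _).1, ← intervalIntegral.integral_of_le zero_le_one]
  · congr 1
    rw [intervalIntegral.integral_eq_sub_of_hasDerivAt_of_le zero_le_one
      (f := fun t => -(√(1 - t^2)) ^ (m+2) / (m+2))]
    · simp; ring
    · exact Continuous.continuousOn (by fun_prop)
    · intro t ht
      have h1 : (1 - t^2) ≠ 0 := by nlinarith [ht.1, ht.2]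
      have h2 : 0 < 1 - t^2 := by nlinarith [ht.1, ht.2]
      have h3 : HasDerivAt (fun t : ℝ => 1 - t^2) (-(2*t)) t := by
        simpa using (hasDerivAt_pow 2 t).const_sub 1
      have h4 := ((h3.sqrt h1).pow (m+2)).neg.div_const ((m:ℝ)+2)
      refine HasDerivAt.congr_deriv h4 ?_
      have h5 := Real.sqrt_pos.2 h2
      have : m + 2 - 1 = m + 1 := rfl
      rw [this]
      push_cast
      have h6 : (m:ℝ) + 2 ≠ 0 := by positivity
      field_simp
      ring
    · exact hc.intervalIntegrable _ _
  · filter_upwards [ae_restrict_mem measurableSet_Ioc] with y hy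
    have := hy.1
    positivity

lemma omegaSlice (m : ℕ) : ∫⁻ x : Euc (m+1), (Iio (1:ℝ)).indicator 1 ‖x‖ * ENNReal.ofReal (x (Fin.last m))
    = volume (ball (0 : Euc m) 1) * ENNReal.ofReal (1/(m+2)) := by
  have h1 := (PiLp.volume_preserving_toLp (Fin (m+1))).lintegral_comp_emb
     (MeasurableEquiv.toLp 2 (Fin (m+1) → ℝ)).measurableEmbedding (fun x : Euc (m+1) => (Iio (1:ℝ)).indicator 1 ‖x‖ * ENNReal.ofReal (x (Fin.last m)))
  have h2 := (volume_preserving_piFinSuccAbove (fun _ : Fin (m + 1) => ℝ) (Fin.last m)).symm.lintegral_comp_emb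
     (MeasurableEquiv.piFinSuccAbove (fun _ : Fin (m + 1) => ℝ) (Fin.last m)).symm.measurableEmbedding (fun x : Fin (m+1) → ℝ => (Iio (1:ℝ)).indicator 1 ‖WithLp.toLp 2 x‖ * ENNReal.ofReal (x (Fin.last m)))
  simp only at h1
  rw [← h1, ← h2]
  have h3 : ∀ p : ℝ × (Fin m → ℝ), (fun x : Fin (m+1) → ℝ => (Iio (1:ℝ)).indicator (1 : ℝ → ℝ≥0∞) ‖WithLp.toLp 2 x‖ * ENNReal.ofReal (x (Fin.last m)))
      ((MeasurableEquiv.piFinSuccAbove (fun _ : Fin (m + 1) => ℝ) (Fin.last m)).symm p)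
      = {q : ℝ × (Fin m → ℝ) | 0 < q.1 ∧ q.1^2 + ∑ i, q.2 i ^ 2 < 1}.indicator (fun q => ENNReal.ofReal q.1) p := by
    intro p
    have e1 : ‖WithLp.toLp 2 ((MeasurableEquiv.piFinSuccAbove (fun _ : Fin (m + 1) => ℝ) (Fin.last m)).symm p)‖ = √(p.1^2 + ∑ i, p.2 i ^ 2) := by
      rw [EuclideanSpace.norm_eq, Fin.sum_univ_castSucc]
      simp [MeasurableEquiv.piFinSuccAbove, Fin.insertNthEquiv, add_comm]
    have e2 : ((MeasurableEquiv.piFinSuccAbove (fun _ : Fin (m + 1) => ℝ) (Fin.last m)).symm p) (Fin.last m) = p.1 := by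
      simp [MeasurableEquiv.piFinSuccAbove, Fin.insertNthEquiv]
    simp only [e1, e2, indicator, mem_Iio, mem_ofPred_eq, Real.sqrt_lt' one_pos, one_pow]
    by_cases hp : 0 < p.1
    · simp [hp]
    · simp [hp, ENNReal.ofReal_of_nonpos (not_lt.1 hp)]
  rw [lintegral_congr h3]
  have hms : MeasurableSet {q : ℝ × (Fin m → ℝ) | 0 < q.1 ∧ q.1^2 + ∑ i, q.2 i ^ 2 < 1} :=
    MeasurableSet.inter (s₁ := {q : ℝ × (Fin m → ℝ) | 0 < q.1}) (s₂ := {q : ℝ × (Fin m → ℝ) | q.1^2 + ∑ i, q.2 i ^ 2 < 1})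
      (measurableSet_lt (by fun_prop) (by fun_prop)) (measurableSet_lt (by fun_prop) (by fun_prop))
  rw [Measure.volume_eq_prod, lintegral_prod _ ((Measurable.indicator (by fun_prop) hms).aemeasurable)]
  have h4 : ∀ t : ℝ, ∫⁻ y : Fin m → ℝ, {q : ℝ × (Fin m → ℝ) | 0 < q.1 ∧ q.1^2 + ∑ i, q.2 i ^ 2 < 1}.indicator (fun q => ENNReal.ofReal q.1) (t, y)
     = (Ioo (0:ℝ) 1).indicator (fun t => ENNReal.ofReal (t * (√(1 - t^2)) ^ m) * volume (ball (0 : Euc m) 1)) t := by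
    intro t
    by_cases ht : t ∈ Ioo (0:ℝ) 1
    · rw [indicator_of_mem ht]
      have h2 : 0 < 1 - t^2 := by nlinarith [ht.1, ht.2]
      have : ∀ y : Fin m → ℝ, {q : ℝ × (Fin m → ℝ) | 0 < q.1 ∧ q.1^2 + ∑ i, q.2 i ^ 2 < 1}.indicator (fun q => ENNReal.ofReal q.1) (t, y)
         = (WithLp.toLp 2 ⁻¹' ball (0 : Euc m) (√(1-t^2))).indicator (fun _ => ENNReal.ofReal t) y := by
        intro y
        have : (t^2 + ∑ i, y i ^ 2 < 1) ↔ (WithLp.toLp 2 y : Euc m) ∈ ball (0 : Euc m) (√(1-t^2)) := by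
          rw [mem_ball_zero_iff, EuclideanSpace.norm_eq, Real.sqrt_lt_sqrt_iff (by positivity)]
          simp
          constructor <;> intro h <;> linarith
        simp only [indicator, Set.mem_ofPred_eq, mem_preimage, ← this, ht.1, true_and]
      rw [lintegral_congr this, lintegral_indicator_const, (PiLp.volume_preserving_toLp (Fin m)).measure_preimage measurableSet_ball.nullMeasurableSet,
        Measure.addHaar_ball_of_pos _ _ (Real.sqrt_pos.2 h2), ENNReal.ofReal_mul ht.1.le, ENNReal.ofReal_pow (by positivity)]
      · simp; ring
      · exact (PiLp.volume_preserving_toLp (Fin m)).measurable measurableSet_ball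
    · rw [indicator_of_notMem ht]
      rw [lintegral_eq_zero_of_ae_eq_zero]
      refine Eventually.of_forall fun y => ?_
      apply indicator_of_notMem
      rintro ⟨h1, h2⟩
      apply ht
      have : 0 ≤ ∑ i, y i ^ 2 := by positivity
      simp only at h1 h2
      exact ⟨h1, by nlinarith⟩
  rw [lintegral_congr h4, lintegral_indicator measurableSet_Ioo, lintegral_mul_const _ (by fun_prop), sliceInt, mul_comm]

lemma polarOmega (m : ℕ) (f : ℝ → ℝ≥0∞) (hf : Measurable f) :
    ∫⁻ x : Euc (m+1), f ‖x‖ * ENNReal.ofReal (x (Fin.last m)) = ENNReal.ofReal (omegaB m)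
      * ∫⁻ ρ in Ioi (0:ℝ), f ρ * ENNReal.ofReal (ρ ^ (m+1)) := by
  have hg : Measurable (fun x : Euc (m+1) => ENNReal.ofReal (x (Fin.last m))) := by fun_prop
  have hgh : ∀ (c : ℝ) (x : Euc (m+1)), 0 < c → ENNReal.ofReal ((c • x) (Fin.last m)) = ENNReal.ofReal c * ENNReal.ofReal (x (Fin.last m)) := by
    intro c x hc
    simp [ENNReal.ofReal_mul hc.le]
  rw [polarAux m f hf _ hg hgh]
  congr 1
  have h := polarBall m _ hg hgh
  rw [omegaSlice] at h
  rw [omegaB, ENNReal.ofReal_toReal measure_ball_lt_top.ne]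
  refine (ENNReal.mul_left_inj ?_ ENNReal.ofReal_ne_top).1 h
  simp; positivity

lemma polarNorm (m : ℕ) : ∃ C : ℝ, 0 < C ∧ ∀ (f : ℝ → ℝ≥0∞) (_ : Measurable f),
    ∫⁻ x : Euc (m+1), f ‖x‖ * ENNReal.ofReal ‖x‖ ≤ ENNReal.ofReal C
      * ∫⁻ ρ in Ioi (0:ℝ), f ρ * ENNReal.ofReal (ρ ^ (m+1)) := by
  have hg : Measurable (fun x : Euc (m+1) => ENNReal.ofReal ‖x‖) := by fun_prop
  have hgh : ∀ (c : ℝ) (x : Euc (m+1)), 0 < c → ENNReal.ofReal ‖c • x‖ = ENNReal.ofReal c * ENNReal.ofReal ‖x‖ := by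
    intro c x hc
    rw [norm_smul, ENNReal.ofReal_mul (by positivity), Real.norm_of_nonneg hc.le]
  set c := (∫⁻ θ : sphere (0 : Euc (m+1)) 1, ENNReal.ofReal ‖(θ : Euc (m+1))‖ ∂(volume : Measure (Euc (m+1))).toSphere) with hc
  have hct : c ≠ ⊤ := by
    simp [hc]
    exact ENNReal.mul_ne_top (by finiteness) (by finiteness)
  refine ⟨c.toReal + 1, by positivity, fun f hf => ?_⟩
  rw [polarAux m f hf _ hg hgh]
  gcongr
  rw [ENNReal.ofReal_add (by positivity) (by positivity), ENNReal.ofReal_toReal hct]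
  exact le_self_add

lemma fubiniShift (m : ℕ) (A B : Set (Euc m)) (hA : MeasurableSet A) (hB : MeasurableSet B)
    (F : ℝ → ℝ≥0∞) (hF : Measurable F) :
    ∫⁻ x in A, ∫⁻ y in B, F (dist x y) = ∫⁻ h, F ‖h‖ * volume {x | x ∈ A ∧ x + h ∈ B} := by
  have hS : MeasurableSet {p : Euc m × Euc m | p.1 ∈ A ∧ p.1 + p.2 ∈ B} :=
    MeasurableSet.inter (s₁ := {p : Euc m × Euc m | p.1 ∈ A}) (s₂ := {p : Euc m × Euc m | p.1 + p.2 ∈ B})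
      (measurable_fst hA) ((measurable_fst.add measurable_snd) hB)
  have h1 : ∀ x, A.indicator (fun x => ∫⁻ y in B, F (dist x y)) x
      = ∫⁻ h, {p : Euc m × Euc m | p.1 ∈ A ∧ p.1 + p.2 ∈ B}.indicator (fun p => F ‖p.2‖) (x, h) := by
    intro x
    by_cases hx : x ∈ A
    · rw [indicator_of_mem hx, ← lintegral_indicator hB, ← lintegral_add_left_eq_self _ x]
      refine lintegral_congr fun h => ?_
      by_cases hh : x + h ∈ B
      · rw [indicator_of_mem hh, indicator_of_mem (by exact ⟨hx, hh⟩)]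
        simp
      · rw [indicator_of_notMem hh, indicator_of_notMem (fun h' => hh h'.2)]
    · rw [indicator_of_notMem hx]
      symm
      rw [lintegral_eq_zero_of_ae_eq_zero]
      exact Eventually.of_forall fun h => indicator_of_notMem (fun h' => hx h'.1) _
  rw [← lintegral_indicator hA, lintegral_congr h1, lintegral_lintegral_swap]
  · refine lintegral_congr fun h => ?_
    have hSh : MeasurableSet {x | x ∈ A ∧ x + h ∈ B} :=
      (measurable_id.prodMk measurable_const : Measurable fun x : Euc m => (x, h)) hS
    rw [← lintegral_indicator_const hSh]
    refine lintegral_congr fun x => ?_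
    simp [indicator]
  · exact (Measurable.indicator (by fun_prop) hS).aemeasurable

lemma supLip (m : ℕ) (x y : Euc m) : |‖x.ofLp‖ - ‖y.ofLp‖| ≤ ‖x - y‖ := by
  refine (abs_norm_sub_norm_le _ _).trans ?_
  rw [← WithLp.ofLp_sub, pi_norm_le_iff_of_nonneg (norm_nonneg _)]
  exact fun i => PiLp.norm_apply_le _ i

/-- cutoff -/
def cutf (m : ℕ) (η : ℝ) (x : Euc m) : ℝ := max 0 (min 1 ((1/2 - η - ‖x.ofLp‖) / η))

lemma cutf_nonneg (m : ℕ) (η : ℝ) (x : Euc m) : 0 ≤ cutf m η x := le_max_left _ _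
lemma cutf_le (m : ℕ) (η : ℝ) (x : Euc m) : cutf m η x ≤ 1 := max_le zero_le_one (min_le_left _ _)

lemma cutf_zero (m : ℕ) (η : ℝ) (hη : 0 < η) (x : Euc m) (hx : 1/2 - η ≤ ‖x.ofLp‖) : cutf m η x = 0 := by
  have : (1/2 - η - ‖x.ofLp‖) / η ≤ 0 := div_nonpos_of_nonpos_of_nonneg (by linarith) hη.le
  exact max_eq_left ((min_le_right _ _).trans this)

lemma cutf_one (m : ℕ) (η : ℝ) (hη : 0 < η) (x : Euc m) (hx : ‖x.ofLp‖ ≤ 1/2 - 2*η) : cutf m η x = 1 := by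
  have : 1 ≤ (1/2 - η - ‖x.ofLp‖) / η := by rw [le_div_iff₀ hη]; linarith
  rw [cutf, min_eq_left this]; simp

lemma cutf_lip (m : ℕ) (η : ℝ) (hη : 0 < η) (x y : Euc m) : |cutf m η x - cutf m η y| ≤ ‖x - y‖ / η := by
  unfold cutf
  refine (abs_max_sub_max_le_max _ _ _ _).trans ?_
  rw [sub_self, abs_zero, max_le_iff]
  refine ⟨by positivity, (abs_min_sub_min_le_max _ _ _ _).trans ?_⟩
  rw [sub_self, abs_zero, max_le_iff]
  refine ⟨by positivity, ?_⟩
  rw [← sub_div, abs_div, abs_of_pos hη]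
  gcongr
  have := supLip m y x
  rw [norm_sub_rev] at this
  refine le_of_eq_of_le ?_ this
  congr 1
  ring

lemma cutf_cont (m : ℕ) (η : ℝ) : Continuous (cutf m η) := by
  unfold cutf; fun_prop

lemma cutf_int (m : ℕ) (η : ℝ) (hη : 0 < η) : Integrable (cutf m η) := by
  refine (cutf_cont m η).integrable_of_hasCompactSupport ?_
  refine HasCompactSupport.intro (K := WithLp.ofLp ⁻¹' closedBall (0 : Fin m → ℝ) (1/2)) ?_ ?_
  · exact (PiLp.homeomorph 2 (fun _ : Fin m => ℝ)).isCompact_preimage.2 (isCompact_closedBall _ _)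
  · intro x hx
    apply cutf_zero m η hη
    simp at hx
    linarith

lemma mem_cube_of (m : ℕ) (x : Euc m) (hx : ‖x.ofLp‖ < 1/2) : x ∈ cube m 1 0 := by
  intro i
  have := (norm_le_pi_norm x.ofLp i).trans_lt hx
  rw [Real.norm_eq_abs, abs_lt] at this
  simp
  constructor <;> linarith [this.1, this.2]

lemma cube_meas (m : ℕ) (l : ℝ) (ξ : Euc m) : MeasurableSet (cube m l ξ) := by
  have : cube m l ξ = ⋂ i, {x : Euc m | x i ∈ Set.Ico (ξ i - l / 2) (ξ i + l / 2)} := by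
    ext x; simp [cube]
  rw [this]
  refine MeasurableSet.iInter fun i => ?_
  have hm : Measurable (fun x : Euc m => x i) := by fun_prop
  exact hm measurableSet_Ico

lemma boxVol (m : ℕ) (η t : ℝ) (hη : 4*η < 1) (ht : 0 ≤ t) :
    volume {x : Euc (m+1) | x (Fin.last m) ∈ Ioc (-t) 0 ∧ ∀ i : Fin m, x i.castSucc ∈ Icc (-(1/2-2*η)) (1/2-2*η)}
      = ENNReal.ofReal (t * (1-4*η)^m) ∧
    MeasurableSet {x : Euc (m+1) | x (Fin.last m) ∈ Ioc (-t) 0 ∧ ∀ i : Fin m, x i.castSucc ∈ Icc (-(1/2-2*η)) (1/2-2*η)} := by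
  set T : Fin (m+1) → Set ℝ := Fin.snoc (α := fun _ => Set ℝ) (fun _ : Fin m => Icc (-(1/2-2*η)) (1/2-2*η)) (Ioc (-t) 0) with hT
  have hTm : ∀ i, MeasurableSet (T i) := by
    intro i
    refine Fin.lastCases ?_ (fun i => ?_) i
    · simp [hT]
    · simp [hT]
  have e : {x : Euc (m+1) | x (Fin.last m) ∈ Ioc (-t) 0 ∧ ∀ i : Fin m, x i.castSucc ∈ Icc (-(1/2-2*η)) (1/2-2*η)}
     = WithLp.ofLp ⁻¹' (Set.pi univ T) := by
    ext x
    simp only [mem_ofPred_eq, mem_preimage, Set.mem_pi, mem_univ, true_imp_iff, Fin.forall_fin_succ', hT,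
      Fin.snoc_last, Fin.snoc_castSucc]
    tauto
  rw [e]
  refine ⟨?_, (PiLp.volume_preserving_ofLp (Fin (m+1))).measurable (MeasurableSet.univ_pi hTm)⟩
  rw [(PiLp.volume_preserving_ofLp (Fin (m+1))).measure_preimage (MeasurableSet.univ_pi hTm).nullMeasurableSet, volume_pi_pi,
    Fin.prod_univ_castSucc]
  simp only [hT, Fin.snoc_last, Fin.snoc_castSucc, Real.volume_Icc, Real.volume_Ioc, Finset.prod_const, Finset.card_univ, Fintype.card_fin]
  rw [← ENNReal.ofReal_pow (by linarith), ← ENNReal.ofReal_mul (by apply pow_nonneg; linarith)]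
  congr 1
  ring

lemma shiftBound (m : ℕ) (η δ : ℝ) (hη : 0 < η) (hη6 : η < 1/6) (hδ : 0 < δ) (E : Set (Euc (m+1))) (hE : MeasurableSet E)
    (hEδ : volume ((E ∆ {x : Euc (m+1) | x (Fin.last m) ≤ 0}) ∩ cube (m+1) 1 0) < ENNReal.ofReal δ)
    (h : Euc (m+1)) (hh : ‖h‖ < η) :
    ENNReal.ofReal ((1-4*η)^m * h (Fin.last m) - δ/η * ‖h‖) ≤
      volume {x | x ∈ cube (m+1) 1 0 ∩ E ∧ x + h ∈ cube (m+1) 1 0 ∩ Eᶜ} := by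
  set Q := cube (m+1) 1 0 with hQ
  have hQm : MeasurableSet Q := cube_meas _ _ _
  set H := {x : Euc (m+1) | x (Fin.last m) ≤ 0} with hH
  have hHm : MeasurableSet H := measurableSet_le (by fun_prop) (by fun_prop)
  set S := {x | x ∈ Q ∩ E ∧ x + h ∈ Q ∩ Eᶜ} with hS
  have hSm : MeasurableSet S := MeasurableSet.inter (s₁ := Q ∩ E) (s₂ := {x | x + h ∈ Q ∩ Eᶜ}) (hQm.inter hE)
    ((measurable_id.add_const h) (hQm.inter hE.compl))
  set φ := cutf (m+1) η with hφ
  have hφi : Integrable φ := cutf_int _ _ hη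
  by_cases hpos : h (Fin.last m) ≤ 0
  · rw [ENNReal.ofReal_of_nonpos]
    · exact zero_le
    · have h1 : 0 ≤ (1-4*η)^m := pow_nonneg (by linarith) _
      have h2 : 0 ≤ δ/η * ‖h‖ := by positivity
      nlinarith
  push Not at hpos
  have hQfin : volume Q ≠ ⊤ := by
    have : Q ⊆ WithLp.ofLp ⁻¹' closedBall (0 : Fin (m+1) → ℝ) (1/2) := by
      intro x hx
      simp only [mem_preimage, mem_closedBall_zero_iff]
      rw [pi_norm_le_iff_of_nonneg (by norm_num)]
      intro i
      have := hx i
      simp at this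
      rw [Real.norm_eq_abs, abs_le]
      constructor <;> linarith [this.1, this.2]
    refine ((measure_mono this).trans_lt ?_).ne
    rw [(PiLp.volume_preserving_ofLp (Fin (m+1))).measure_preimage measurableSet_closedBall.nullMeasurableSet]
    exact measure_closedBall_lt_top
  have hSfin : volume S ≠ ⊤ := ne_top_of_le_ne_top hQfin (measure_mono fun x hx => hx.1.1)
  -- support facts
  have hs1 : ∀ x, φ x ≠ 0 → x ∈ Q ∧ x + h ∈ Q := by
    intro x hx
    have h1 : ‖x.ofLp‖ < 1/2 - η := by
      by_contra hc; exact hx (cutf_zero _ _ hη _ (not_lt.1 hc))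
    refine ⟨mem_cube_of _ _ (by linarith), mem_cube_of _ _ ?_⟩
    have := supLip (m+1) (x+h) x
    rw [add_sub_cancel_left, abs_le] at this
    linarith [this.2]
  have key : ∀ G : Set (Euc (m+1)), MeasurableSet G →
      ∫ x, φ x * (G.indicator 1 x - G.indicator 1 (x + h)) = ∫ x, (φ x - φ (x - h)) * G.indicator 1 x ∧
      Integrable (fun x => φ x * (G.indicator 1 x - G.indicator (1 : Euc (m+1) → ℝ) (x + h))) ∧
      Integrable (fun x => (φ x - φ (x - h)) * G.indicator (1 : Euc (m+1) → ℝ) x) := by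
    intro G hG
    have hb : ∀ x, ‖G.indicator (1 : Euc (m+1) → ℝ) x‖ ≤ 1 := by
      intro x; by_cases hx : x ∈ G <;> simp [hx]
    have hGm : Measurable (G.indicator (1 : Euc (m+1) → ℝ)) := measurable_one.indicator hG
    have i1 : Integrable (fun x => φ x * G.indicator (1 : Euc (m+1) → ℝ) x) :=
      hφi.mul_bdd (c := 1) hGm.aestronglyMeasurable (Eventually.of_forall hb)
    have i2 : Integrable (fun x => φ x * G.indicator (1 : Euc (m+1) → ℝ) (x+h)) :=
      hφi.mul_bdd (c := 1) (hGm.comp (measurable_id.add_const h)).aestronglyMeasurable (Eventually.of_forall fun x => hb _)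
    have i3 : Integrable (fun x => φ (x - h) * G.indicator (1 : Euc (m+1) → ℝ) x) :=
      (hφi.comp_sub_right h).mul_bdd (c := 1) hGm.aestronglyMeasurable (Eventually.of_forall hb)
    have e3 : ∫ x, φ x * G.indicator (1 : Euc (m+1) → ℝ) (x+h) = ∫ x, φ (x - h) * G.indicator (1 : Euc (m+1) → ℝ) x := by
      rw [← integral_add_right_eq_self (fun x => φ (x - h) * G.indicator (1 : Euc (m+1) → ℝ) x) h]
      simp
    simp only [mul_sub, sub_mul]
    refine ⟨?_, i1.sub i2, i1.sub i3⟩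
    rw [integral_sub i1 i2, integral_sub i1 i3, e3]
  obtain ⟨k1, k2, k3⟩ := key E hE
  obtain ⟨l1, l2, l3⟩ := key H hHm
  -- step 1
  have s1 : ∫ x, φ x * (E.indicator 1 x - E.indicator 1 (x + h)) ≤ volume.real S := by
    rw [← integral_indicator_one hSm]
    refine integral_mono k2 ((integrable_indicator_iff hSm).2 (integrableOn_const hSfin)) fun x => ?_
    simp only
    by_cases hx : φ x = 0
    · rw [hx, zero_mul]; exact indicator_nonneg (fun _ _ => zero_le_one) _
    obtain ⟨q1, q2⟩ := hs1 x hx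
    have c0 := cutf_nonneg (m+1) η x
    have c1 := cutf_le (m+1) η x
    by_cases a : x ∈ E <;> by_cases b : x + h ∈ E
    · simp [a, b, indicator_nonneg]
    · have : x ∈ S := ⟨⟨q1, a⟩, q2, b⟩
      simp [a, b, this]; exact c1
    · have : x ∉ S := fun h => a h.1.2
      simp [a, b, this]; exact c0
    · simp [a, b, indicator_nonneg]
  -- step 2
  have s2 : (1-4*η)^m * h (Fin.last m) ≤ ∫ x, φ x * (H.indicator 1 x - H.indicator 1 (x + h)) := by
    obtain ⟨b1, b2⟩ := boxVol m η (h (Fin.last m)) (by linarith) hpos.le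
    set B := {x : Euc (m+1) | x (Fin.last m) ∈ Ioc (-(h (Fin.last m))) 0 ∧ ∀ i : Fin m, x i.castSucc ∈ Icc (-(1/2-2*η)) (1/2-2*η)} with hB
    have : (1-4*η)^m * h (Fin.last m) = volume.real B := by
      rw [measureReal_def, b1, ENNReal.toReal_ofReal, mul_comm]
      apply mul_nonneg hpos.le (pow_nonneg (by linarith) _)
    rw [this, ← integral_indicator_one b2]
    refine integral_mono ((integrable_indicator_iff b2).2 (integrableOn_const (by rw [b1]; exact ENNReal.ofReal_ne_top))) l2 fun x => ?_
    simp only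
    have c0 := cutf_nonneg (m+1) η x
    have hHx : ∀ y, H.indicator (1 : Euc (m+1) → ℝ) y = if y (Fin.last m) ≤ 0 then 1 else 0 := by
      intro y; simp [indicator, hH]
    rw [hHx, hHx]
    by_cases hx : x ∈ B
    · have hle : h (Fin.last m) ≤ ‖h‖ := (le_abs_self _).trans (PiLp.norm_apply_le h _)
      have : φ x = 1 := by
        apply cutf_one _ _ hη
        rw [pi_norm_le_iff_of_nonneg (by linarith), Fin.forall_fin_succ']
        refine ⟨fun i => ?_, ?_⟩
        · exact abs_le.2 (hx.2 i)
        · have := hx.1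
          exact abs_le.2 ⟨by linarith [this.1], by linarith [this.2]⟩
      rw [indicator_of_mem hx, this, if_pos hx.1.2, if_neg]
      · simp
      · have := hx.1.1
        simp; linarith
    · rw [indicator_of_notMem hx]
      apply mul_nonneg c0
      split_ifs with a b b
      · simp
      · simp
      · exfalso
        simp at b
        linarith
      · simp
  -- step 3
  have s3 : (∫ x, (φ x - φ (x - h)) * H.indicator 1 x) - δ/η * ‖h‖ ≤ ∫ x, (φ x - φ (x - h)) * E.indicator 1 x := by
    set D := (E ∆ H) ∩ Q with hD
    have hDm : MeasurableSet D := (hE.symmDiff hHm).inter hQm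
    have hDr : volume.real D ≤ δ := by
      rw [measureReal_def]; exact ENNReal.toReal_le_of_le_ofReal hδ.le hEδ.le
    have hDfin : volume D ≠ ⊤ := (hEδ.trans ENNReal.ofReal_lt_top).ne
    have id : Integrable (D.indicator (fun _ => ‖h‖/η)) := (integrable_indicator_iff hDm).2 (integrableOn_const hDfin)
    have : ∫ x, (φ x - φ (x - h)) * H.indicator 1 x ≤ ∫ x, ((φ x - φ (x - h)) * E.indicator 1 x + D.indicator (fun _ => ‖h‖/η) x) := by
      refine integral_mono l3 (k3.add id) fun x => ?_
      simp only
      have c0 : |φ x - φ (x - h)| ≤ ‖h‖/η := by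
        have := cutf_lip (m+1) η hη x (x - h)
        rwa [sub_sub_cancel] at this
      have dn : 0 ≤ D.indicator (fun _ => ‖h‖/η) x := indicator_nonneg (fun _ _ => by positivity) _
      by_cases hx : x ∈ Q
      · rw [abs_le] at c0
        by_cases a : x ∈ E <;> by_cases b : x ∈ H
        · simp [a, b, dn]
        · have : x ∈ D := ⟨Or.inl ⟨a, b⟩, hx⟩
          simp [a, b, this]; linarith [c0.1]
        · have : x ∈ D := ⟨Or.inr ⟨b, a⟩, hx⟩
          simp [a, b, this]; linarith [c0.2]
        · simp [a, b, dn]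
      · have z1 : φ x = 0 := by
          by_contra hc; exact hx (hs1 x hc).1
        have z2 : φ (x - h) = 0 := by
          by_contra hc
          have := (hs1 _ hc).2
          rw [sub_add_cancel] at this
          exact hx this
        rw [z1, z2]; simpa using dn
    rw [integral_add k3 id, integral_indicator_const _ hDm, smul_eq_mul] at this
    have h2 : volume.real D * (‖h‖/η) ≤ δ/η * ‖h‖ := by
      calc _ ≤ δ * (‖h‖/η) := by gcongr
        _ = _ := by ring
    linarith
  refine ENNReal.ofReal_le_of_le_toReal ?_
  rw [← measureReal_def]
  linarith

lemma ker_meas (d : ℕ) (s r : ℝ) : Measurable (ker d s r) := by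
  unfold _root_.ker
  exact Measurable.ite measurableSet_Iic measurable_const (by fun_prop)

lemma radial (m : ℕ) (s r η : ℝ) (hs : 1 < s) (hr : 0 < r) (hrη : r < η) :
    ∫⁻ ρ in Ioi (0:ℝ), (Iio η).indicator (fun ρ => ENNReal.ofReal (ker (m+1) s r ρ)) ρ * ENNReal.ofReal (ρ ^ (m+1))
      = ENNReal.ofReal (betaScale (m+1) s r - (η ^ (1-s) - 1)/(s-1)) := by
  have h0 : ∀ ρ, (Iio η).indicator (fun ρ => ENNReal.ofReal (ker (m+1) s r ρ)) ρ * ENNReal.ofReal (ρ ^ (m+1))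
     = (Iio η).indicator (fun ρ => ENNReal.ofReal (ker (m+1) s r ρ) * ENNReal.ofReal (ρ ^ (m+1))) ρ := by
    intro ρ; by_cases h : ρ < η <;> simp [h]
  have hη : 0 < η := hr.trans hrη
  rw [lintegral_congr h0, lintegral_indicator measurableSet_Iio, Measure.restrict_restrict measurableSet_Iio,
    Set.inter_comm, Ioi_inter_Iio, ← Ioc_union_Ioo_eq_Ioo hr.le hrη,
    lintegral_union measurableSet_Ioo (by
      rw [Set.disjoint_left]; intro x hx hx'; exact absurd hx.2 (not_le.2 hx'.1))]
  have e1 : ∫⁻ ρ in Ioc 0 r, ENNReal.ofReal (ker (m+1) s r ρ) * ENNReal.ofReal (ρ ^ (m+1))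
     = ENNReal.ofReal (r ^ (1-s) / (m+2)) := by
    have : ∀ ρ ∈ Ioc 0 r, ENNReal.ofReal (ker (m+1) s r ρ) * ENNReal.ofReal (ρ ^ (m+1)) =
        ENNReal.ofReal (r ^ (-(((m+1 : ℕ) : ℝ) + s)) * ρ ^ (m+1)) := by
      intro ρ hρ
      rw [_root_.ker, if_pos hρ.2, ENNReal.ofReal_mul (by positivity)]
    rw [setLIntegral_congr_fun measurableSet_Ioc this, ← ofReal_integral_eq_lintegral_ofReal
      ((Continuous.intervalIntegrable (by fun_prop) _ _).1), ← intervalIntegral.integral_of_le hr.le]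
    · congr 1
      simp only [intervalIntegral.integral_const_mul, integral_pow]
      have : r ^ (1 - s) = r ^ (-(((m+1 : ℕ) : ℝ) + s)) * r ^ (m+2) := by
        rw [← Real.rpow_natCast r (m+2), ← Real.rpow_add hr]
        congr 1; push_cast; ring
      rw [this]
      push_cast
      simp
      ring
    · filter_upwards [ae_restrict_mem measurableSet_Ioc] with y hy
      have := hy.1
      positivity
  have e2 : ∫⁻ ρ in Ioo r η, ENNReal.ofReal (ker (m+1) s r ρ) * ENNReal.ofReal (ρ ^ (m+1))
     = ENNReal.ofReal ((r ^ (1-s) - η ^ (1-s)) / (s-1)) := by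
    have : ∀ ρ ∈ Ioo r η, ENNReal.ofReal (ker (m+1) s r ρ) * ENNReal.ofReal (ρ ^ (m+1)) =
        ENNReal.ofReal (ρ ^ (-s)) := by
      intro ρ hρ
      have hρ0 : 0 < ρ := hr.trans hρ.1
      rw [_root_.ker, if_neg (not_le.2 hρ.1), ← ENNReal.ofReal_mul (by positivity), ← Real.rpow_natCast ρ (m+1), ← Real.rpow_add hρ0]
      congr 2; push_cast; ring
    have hmem : (0:ℝ) ∉ uIcc r η := by
      rw [uIcc_of_le hrη.le]; intro h; linarith [h.1]
    rw [setLIntegral_congr_fun measurableSet_Ioo this, Measure.restrict_congr_set Ioo_ae_eq_Ioc, ← ofReal_integral_eq_lintegral_ofReal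
      ((intervalIntegral.intervalIntegrable_rpow (Or.inr hmem)).1), ← intervalIntegral.integral_of_le hrη.le]
    · congr 1
      rw [integral_rpow (Or.inr ⟨by linarith, hmem⟩)]
      have h1 : -s + 1 = 1 - s := by ring
      have h2 : 1 - s ≠ 0 := by linarith
      have h3 : s - 1 ≠ 0 := by linarith
      rw [h1]
      field_simp
      ring
    · filter_upwards [ae_restrict_mem measurableSet_Ioc] with y hy
      have := hr.trans hy.1
      positivity
  have h3 : 0 < s - 1 := by linarith
  have hle : η ^ (1-s) ≤ r ^ (1-s) := Real.rpow_le_rpow_of_nonpos hr hrη.le (by linarith)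
  rw [e1, e2, ← ENNReal.ofReal_add (by positivity) (div_nonneg (by linarith) h3.le)]
  congr 1
  unfold betaScale
  push_cast
  have h4 : (m:ℝ) + 2 ≠ 0 := by positivity
  have h5 : (m:ℝ) + 1 + 1 ≠ 0 := by positivity
  have h6 : s - 1 ≠ 0 := h3.ne'
  field_simp
  ring

lemma flatBound (m : ℕ) (C : ℝ) (hC0 : 0 < C) (hC : ∀ (f : ℝ → ℝ≥0∞) (_ : Measurable f),
    ∫⁻ x : Euc (m+1), f ‖x‖ * ENNReal.ofReal ‖x‖ ≤ ENNReal.ofReal C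
      * ∫⁻ ρ in Ioi (0:ℝ), f ρ * ENNReal.ofReal (ρ ^ (m+1)))
    (η δ : ℝ) (hη : 0 < η) (hη6 : η < 1/6) (hδ : 0 < δ) (E : Set (Euc (m+1))) (hE : MeasurableSet E)
    (hEδ : volume ((E ∆ {x : Euc (m+1) | x (Fin.last m) ≤ 0}) ∩ cube (m+1) 1 0) < ENNReal.ofReal δ)
    (s r : ℝ) (hs : 1 < s) (hr : 0 < r) (hrη : r < η) :
    ENNReal.ofReal ((1-4*η)^m * omegaB m - δ/η * C) * ENNReal.ofReal (betaScale (m+1) s r - (η ^ (1-s) - 1)/(s-1))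
     ≤ ∫⁻ x in cube (m+1) 1 0 ∩ E, ∫⁻ y in cube (m+1) 1 0 ∩ Eᶜ, ENNReal.ofReal (ker (m+1) s r (dist x y)) := by
  have hQm : MeasurableSet (cube (m+1) 1 0) := cube_meas _ _ _
  have hFm : Measurable (fun ρ => ENNReal.ofReal (ker (m+1) s r ρ)) := (ker_meas _ _ _).ennreal_ofReal
  rw [fubiniShift (m+1) _ _ (hQm.inter hE) (hQm.inter hE.compl) (fun ρ => ENNReal.ofReal (ker (m+1) s r ρ)) hFm]
  set f := (Iio η).indicator (fun ρ => ENNReal.ofReal (ker (m+1) s r ρ)) with hf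
  have hfm : Measurable f := hFm.indicator measurableSet_Iio
  have ha : 0 ≤ (1-4*η)^m := pow_nonneg (by linarith) _
  have hb : 0 ≤ δ/η := by positivity
  have hftop : ∀ ρ, f ρ ≠ ⊤ := by
    intro ρ; by_cases h : ρ < η <;> simp [hf, h]
  calc _ = ENNReal.ofReal ((1-4*η)^m) * (∫⁻ x : Euc (m+1), f ‖x‖ * ENNReal.ofReal (x (Fin.last m)))
        - ENNReal.ofReal (δ/η) * (ENNReal.ofReal C * ∫⁻ ρ in Ioi (0:ℝ), f ρ * ENNReal.ofReal (ρ ^ (m+1))) := by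
        rw [polarOmega m f hfm, hf, radial m s r η hs hr hrη, ← mul_assoc, ← mul_assoc, ← ENNReal.ofReal_mul ha,
          ← ENNReal.ofReal_mul hb, ← ENNReal.sub_mul (fun _ _ => ENNReal.ofReal_ne_top), ENNReal.ofReal_sub _ (by positivity)]
    _ ≤ ENNReal.ofReal ((1-4*η)^m) * (∫⁻ x : Euc (m+1), f ‖x‖ * ENNReal.ofReal (x (Fin.last m)))
        - ENNReal.ofReal (δ/η) * (∫⁻ x : Euc (m+1), f ‖x‖ * ENNReal.ofReal ‖x‖) := by
        gcongr
        exact hC f hfm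
    _ = (∫⁻ x : Euc (m+1), ENNReal.ofReal ((1-4*η)^m) * (f ‖x‖ * ENNReal.ofReal (x (Fin.last m))))
        - (∫⁻ x : Euc (m+1), ENNReal.ofReal (δ/η) * (f ‖x‖ * ENNReal.ofReal ‖x‖)) := by
        rw [lintegral_const_mul _ (by fun_prop), lintegral_const_mul _ (by fun_prop)]
    _ ≤ ∫⁻ x : Euc (m+1), (ENNReal.ofReal ((1-4*η)^m) * (f ‖x‖ * ENNReal.ofReal (x (Fin.last m)))
        - ENNReal.ofReal (δ/η) * (f ‖x‖ * ENNReal.ofReal ‖x‖)) := lintegral_sub_le _ _ (by fun_prop)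
    _ ≤ _ := by
        refine lintegral_mono fun h => ?_
        have e : ENNReal.ofReal ((1-4*η)^m) * (f ‖h‖ * ENNReal.ofReal (h (Fin.last m)))
        - ENNReal.ofReal (δ/η) * (f ‖h‖ * ENNReal.ofReal ‖h‖) = f ‖h‖ * ENNReal.ofReal ((1-4*η)^m * h (Fin.last m) - δ/η * ‖h‖) := by
          rw [ENNReal.ofReal_sub _ (by positivity), ENNReal.mul_sub (fun _ _ => hftop _), ENNReal.ofReal_mul ha, ENNReal.ofReal_mul hb]
          ring_nf
        simp only
        rw [e]
        by_cases hh : ‖h‖ < η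
        · rw [hf, indicator_of_mem (by exact hh)]
          gcongr
          exact shiftBound m η δ hη hη6 hδ E hE hEδ h hh
        · rw [hf, indicator_of_notMem (by exact hh), zero_mul]
          exact zero_le

lemma rotBound (m : ℕ) (R : Euc (m+1) ≃ₗᵢ[ℝ] Euc (m+1)) (ν : Euc (m+1))
    (hR : R (EuclideanSpace.single (Fin.last m) 1) = ν) (E : Set (Euc (m+1))) (hE : MeasurableSet E) (F : ℝ → ℝ≥0∞) :
    volume ((E ∆ Hminus (m+1) ν) ∩ (R '' cube (m+1) 1 0)) =
      volume (((R ⁻¹' E) ∆ {x : Euc (m+1) | x (Fin.last m) ≤ 0}) ∩ cube (m+1) 1 0) ∧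
    ∫⁻ x in (R '' cube (m+1) 1 0) ∩ E, ∫⁻ y in (R '' cube (m+1) 1 0) ∩ Eᶜ, F (dist x y) =
      ∫⁻ x in cube (m+1) 1 0 ∩ (R ⁻¹' E), ∫⁻ y in cube (m+1) 1 0 ∩ (R ⁻¹' E)ᶜ, F (dist x y) := by
  have hmp : MeasurePreserving R volume volume := R.measurePreserving
  have hemb : MeasurableEmbedding R := R.toHomeomorph.measurableEmbedding
  have hpre : R ⁻¹' (R '' cube (m+1) 1 0) = cube (m+1) 1 0 := preimage_image_eq _ R.injective
  constructor
  · rw [← hmp.measure_preimage_emb hemb, preimage_inter, hpre]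
    congr 2
    have : R ⁻¹' (Hminus (m+1) ν) = {x : Euc (m+1) | x (Fin.last m) ≤ 0} := by
      ext x
      simp only [Hminus, mem_preimage, mem_ofPred_eq]
      rw [← hR, LinearIsometryEquiv.inner_map_map]
      simp [EuclideanSpace.inner_single_left]
    rw [← this]
    rfl
  · rw [← hmp.setLIntegral_comp_preimage_emb hemb, preimage_inter, hpre]
    refine lintegral_congr fun x => ?_
    rw [← hmp.setLIntegral_comp_preimage_emb hemb, preimage_inter, hpre]
    simp [LinearIsometryEquiv.dist_map]

lemma betaLower (m : ℕ) (s r : ℝ) (hs : 1 < s) (hr : 0 < r) (hr1 : r < 1) : -Real.log r ≤ betaScale (m+1) s r := by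
  unfold betaScale
  have h3 : 0 < s - 1 := by linarith
  have hl : 0 < -Real.log r := by linarith [Real.log_neg hr hr1]
  have h1 : -Real.log r ≤ (r ^ (1-s) - 1)/(s-1) := by
    rw [le_div_iff₀ h3, Real.rpow_def_of_pos hr]
    have := Real.add_one_le_exp (Real.log r * (1-s))
    linarith
  have h2 : 1 ≤ (((m+1:ℕ):ℝ) + s)/(((m+1:ℕ):ℝ) + 1) := by
    rw [le_div_iff₀ (by positivity)]; linarith
  have h4 : (0:ℝ) ≤ 1 / (((m+1:ℕ):ℝ) + 1) := by positivity
  nlinarith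

lemma Mupper (s η : ℝ) (hs : 1 < s) (hs2 : s ≤ 2) (hη : 0 < η) (hη1 : η < 1) :
    (η ^ (1-s) - 1)/(s-1) ≤ -Real.log η * η⁻¹ := by
  have h3 : 0 < s - 1 := by linarith
  have hl : 0 < -Real.log η := by linarith [Real.log_neg hη hη1]
  rw [div_le_iff₀ h3]
  have h1 : η ^ (1-s) - 1 ≤ (-Real.log η * (s-1)) * η ^ (1-s) := by
    rw [Real.rpow_def_of_pos hη]
    have := Real.add_one_le_exp (-(Real.log η * (1-s)))
    have h5 := Real.exp_pos (Real.log η * (1-s))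
    have h6 : Real.exp (-(Real.log η * (1-s))) * Real.exp (Real.log η * (1-s)) = 1 := by
      rw [← Real.exp_add]; simp
    nlinarith
  have h2 : η ^ (1-s) ≤ η⁻¹ := by
    rw [← Real.rpow_neg_one]
    exact Real.rpow_le_rpow_of_exponent_ge hη hη1.le (by linarith)
  have : (-Real.log η * (s-1)) * η ^ (1-s) ≤ (-Real.log η * (s-1)) * η⁻¹ := by gcongr
  linarith

/-- Quantitative lower bound on the nonlocal energies `J̃^{s_n}_{r_n}` of
sets close, in a unit cube `Q^ν` oriented along `ν`, to the half-space `H⁻_ν(0)`,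
in the simultaneous limit `r_n → 0⁺`, `s_n → 1⁺`. -/
theorem stmt17 (d : ℕ) (hd : 2 ≤ d)
    (r : ℕ → ℝ) (hr : ∀ n, r n ∈ Set.Ioo (0 : ℝ) 1) (hr0 : Tendsto r atTop (nhds 0))
    (s : ℕ → ℝ) (hs : ∀ n, 1 < s n) (hs1 : Tendsto s atTop (nhds 1))
    (ε : ℝ) (hε : 0 < ε) :
    ∃ δ₀ : ℝ, 0 < δ₀ ∧ ∃ nbar : ℕ,
      ∀ ν : Euc d, ‖ν‖ = 1 →
      ∀ R : Euc d ≃ₗᵢ[ℝ] Euc d,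
        R (EuclideanSpace.single (⟨d - 1, by omega⟩ : Fin d) 1) = ν →
      ∀ E : Set (Euc d), MeasurableSet E → volume E < ⊤ →
        volume ((E ∆ Hminus d ν) ∩ (R '' cube d 1 0)) < ENNReal.ofReal δ₀ →
      ∀ n : ℕ, nbar ≤ n →
        ENNReal.ofReal (omegaB (d - 1) * (1 - ε) * betaScale d (s n) (r n)) ≤
          ∫⁻ x in (R '' cube d 1 0) ∩ E, ∫⁻ y in (R '' cube d 1 0) ∩ Eᶜ,
            ENNReal.ofReal (ker d (s n) (r n) (dist x y)) := by
  obtain ⟨m, rfl⟩ : ∃ m, d = m + 1 := ⟨d - 1, by omega⟩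
  have hω : 0 < omegaB m := ENNReal.toReal_pos (measure_ball_pos volume _ one_pos).ne' measure_ball_lt_top.ne
  obtain ⟨C, hC0, hC⟩ := polarNorm m
  -- choose η
  obtain ⟨η, hη, hη6, hηε⟩ : ∃ η : ℝ, 0 < η ∧ η < 1/6 ∧ 1 - ε/3 ≤ (1-4*η)^m := by
    have hc : Tendsto (fun η : ℝ => (1-4*η)^m) (nhdsWithin 0 (Ioi 0)) (nhds 1) := by
      have : Continuous (fun η : ℝ => (1-4*η)^m) := by fun_prop
      have := this.tendsto 0
      simp only [mul_zero, sub_zero, one_pow] at this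
      exact this.mono_left nhdsWithin_le_nhds
    have h1 := hc.eventually (lt_mem_nhds (show 1 - ε/3 < 1 by linarith))
    have h2 : ∀ᶠ η in nhdsWithin (0:ℝ) (Ioi 0), η ∈ Ioo (0:ℝ) (1/6) := Ioo_mem_nhdsGT (by norm_num)
    obtain ⟨η, h3, h4⟩ := (h1.and h2).exists
    exact ⟨η, h4.1, h4.2, h3.le⟩
  set M := -Real.log η * η⁻¹ with hM
  have hlog : Tendsto (fun n => -Real.log (r n)) atTop atTop := by
    refine tendsto_neg_atBot_atTop.comp (Real.tendsto_log_nhdsGT_zero.comp ?_)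
    exact tendsto_nhdsWithin_iff.2 ⟨hr0, Eventually.of_forall fun n => (hr n).1⟩
  have hev := (hr0.eventually (gt_mem_nhds hη)).and ((hs1.eventually (gt_mem_nhds (one_lt_two))).and
    (hlog.eventually_ge_atTop (3 * M / ε)))
  obtain ⟨nbar, hn⟩ := eventually_atTop.1 hev
  refine ⟨ε/3 * omegaB m * η / C, by positivity, nbar, ?_⟩
  intro ν _ R hR E hE _ hEδ n hnn
  obtain ⟨n1, n2, n3⟩ := hn n hnn
  have hrot := rotBound m R ν hR E hE (fun t => ENNReal.ofReal (ker (m+1) (s n) (r n) t))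
  rw [hrot.1] at hEδ
  rw [hrot.2]
  have hE' : MeasurableSet (R ⁻¹' E) := R.continuous.measurable hE
  refine le_trans ?_ (flatBound m C hC0 hC η _ hη hη6 (by positivity) _ hE' hEδ (s n) (r n) (hs n) (hr n).1 n1)
  have hβ := betaLower m (s n) (r n) (hs n) (hr n).1 (hr n).2
  have hMu := Mupper (s n) η (hs n) n2.le hη (by linarith)
  rw [← hM] at hMu
  have hβ0 : 0 < betaScale (m+1) (s n) (r n) := by linarith [Real.log_neg (hr n).1 (hr n).2]
  by_cases hε1 : 1 ≤ ε
  · rw [ENNReal.ofReal_of_nonpos]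
    · exact zero_le
    · show omegaB m * (1 - ε) * _ ≤ 0
      have : omegaB m * (1 - ε) ≤ 0 := mul_nonpos_of_nonneg_of_nonpos hω.le (by linarith)
      exact mul_nonpos_of_nonpos_of_nonneg this hβ0.le
  push Not at hε1
  have hMβ : M ≤ ε/3 * betaScale (m+1) (s n) (r n) := by
    have := n3.trans hβ
    rw [div_le_iff₀ hε] at this
    linarith
  have e1 : ε/3 * omegaB m * η / C / η * C = ε/3 * omegaB m := by field_simp
  rw [e1]
  have g1 : omegaB m * (1 - 2*ε/3) ≤ (1-4*η)^m * omegaB m - ε/3 * omegaB m := by nlinarith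
  have g2 : (1 - ε/3) * betaScale (m+1) (s n) (r n) ≤ betaScale (m+1) (s n) (r n) - (η ^ (1-s n) - 1)/(s n-1) := by linarith
  have g0 : 0 ≤ omegaB m * (1 - 2*ε/3) := mul_nonneg hω.le (by linarith)
  have g3 : 0 ≤ (1 - ε/3) * betaScale (m+1) (s n) (r n) := mul_nonneg (by linarith) hβ0.le
  rw [← ENNReal.ofReal_mul (g0.trans g1)]
  apply ENNReal.ofReal_le_ofReal
  refine le_trans ?_ (mul_le_mul g1 g2 g3 (g0.trans g1))
  show omegaB m * (1 - ε) * _ ≤ _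
  have : omegaB m * (1 - 2*ε/3) * ((1 - ε/3) * betaScale (m+1) (s n) (r n)) = omegaB m * (1 - ε) * betaScale (m+1) (s n) (r n)
     + 2*ε^2/9 * (omegaB m * betaScale (m+1) (s n) (r n)) := by ring
  rw [this]
  have : 0 ≤ 2*ε^2/9 * (omegaB m * betaScale (m+1) (s n) (r n)) := by positivity
  linarith

end
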